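/- arXiv:1909.10689 — 3 statements merged into one kernel-verified Lean document; each statement's English description precedes it below -/
import Mathlib

section
/- Let α > 1 - 1/p, 1 < p < ∞, R > e. There exist positive constants C₆ and L such that for every u ∈ C_c^∞((0,1]): ∫₀¹ (|u'|^p − Λ_{α,p}|u/t|^p) t^{αp} dt + L|u(1)|^p ≥ C₆ ∫₀¹ |u'|^p t^{αp} (log(R/t))^{-2} dt. -/
open MeasureTheory Real Set

lemma aux_young (p q0 y U X : ℝ) (hp : 1 < p) (hy : 0 ≤ y) (hU : 0 ≤ U) (hX : 0 ≤ X) :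
    p * y * U ^ (p-1) * X ≤ exp (-(p-1)*q0) * X ^ p
      + (p-1) * exp q0 * y ^ (p/(p-1)) * U ^ p := by
  have hp1 : 0 < p - 1 := by linarith
  have hp0 : 0 < p := by linarith
  have hc : p.HolderConjugate (p/(p-1)) := Real.HolderConjugate.conjExponent hp
  have h := Real.young_inequality_of_nonneg (a := exp (-(p-1)*q0/p) * X)
    (b := y * U^(p-1) * exp ((p-1)*q0/p)) (by positivity) (by positivity) hc
  have e1 : (exp (-(p-1)*q0/p) * X)^p = exp (-(p-1)*q0) * X^p := by
    rw [Real.mul_rpow (exp_pos _).le hX, ← Real.exp_mul]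
    congr 2; field_simp
  have e2 : (y * U^(p-1) * exp ((p-1)*q0/p))^(p/(p-1)) = y^(p/(p-1)) * U^p * exp q0 := by
    rw [Real.mul_rpow (by positivity) (exp_pos _).le, Real.mul_rpow hy (by positivity),
      ← Real.exp_mul, ← Real.rpow_mul hU]
    congr 2
    · congr 1; field_simp
    · field_simp
  rw [e1, e2] at h
  have e3 : exp (-(p-1)*q0/p) * X * (y * U^(p-1) * exp ((p-1)*q0/p)) = y * U^(p-1) * X := by
    have : exp (-(p-1)*q0/p) * exp ((p-1)*q0/p) = 1 := by
      rw [← Real.exp_add, ← Real.exp_zero]; congr 1; ring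
    linear_combination (X * y * U^(p-1)) * this
  rw [e3] at h
  have h2 := mul_le_mul_of_nonneg_left h hp0.le
  have e4 : p * (exp (-(p-1)*q0) * X^p / p + y^(p/(p-1)) * U^p * exp q0 / (p/(p-1)))
      = exp (-(p-1)*q0) * X^p + (p-1) * exp q0 * y ^ (p/(p-1)) * U^p := by
    field_simp
  rw [e4] at h2
  linarith

/-- The scalar inequality. -/
lemma aux_scalar (p β k s : ℝ) (hp : 1 < p) (hβ : 0 < β) (hk : 0 < k) (hk1 : k ≤ 1)
    (hk2 : (p/(p-1) + 1) * k ≤ 1) (hk3 : β * (p-1) * (1 + (p/(p-1)+1)^2) * k ≤ 1)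
    (hs : 1 ≤ s) :
    (p-1) * exp (k^2/s^2) * (β^(p-1) * (1 + k/s)) ^ (p/(p-1)) + β ^ p
      ≤ β * p * (β^(p-1) * (1 + k/s)) + β^(p-1) * k / s^2 := by
  have hp1 : 0 < p - 1 := by linarith
  have hp0 : 0 < p := by linarith
  have hs0 : 0 < s := by linarith
  set r := p/(p-1) with hr
  have hr0 : 0 < r := by positivity
  have hpr : (p-1) * r = p := by rw [hr]; field_simp
  set d := k/s with hd
  have hd0 : 0 < d := by positivity
  have hdk : d ≤ k := div_le_self hk.le hs
  have e1 : (β^(p-1) * (1 + d)) ^ r = β^p * (1+d)^r := by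
    rw [Real.mul_rpow (by positivity) (by positivity), ← Real.rpow_mul hβ.le, hpr]
  have e2 : k^2/s^2 = d^2 := by rw [hd]; ring
  have e3 : β^p = β^(p-1) * β := by
    rw [← Real.rpow_add_one hβ.ne']; congr 1; ring
  have h1 : (1+d)^r ≤ exp (d * r) := by
    rw [Real.exp_mul]
    exact Real.rpow_le_rpow (by positivity) (by linarith [Real.add_one_le_exp d]) hr0.le
  have hdd : d^2 ≤ d := by nlinarith
  have h2 : exp (d^2) * (1+d)^r ≤ 1 + r * d + d^2 * (1 + (r+1)^2) := by
    have hz : d^2 + d * r ≤ (r+1)*d := by nlinarith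
    have hz0 : 0 ≤ d^2 + d * r := by positivity
    have hz1 : (r+1)*d ≤ 1 := le_trans (by gcongr) hk2
    have h3 := Real.abs_exp_sub_one_sub_id_le (x := d^2 + d*r)
      (by rw [abs_of_nonneg hz0]; linarith)
    have h4 := (abs_le.1 h3).2
    have h5 : (d^2 + d*r)^2 ≤ ((r+1)*d)^2 := by gcongr
    calc exp (d^2) * (1+d)^r ≤ exp (d^2) * exp (d*r) := by gcongr
      _ = exp (d^2 + d*r) := by rw [Real.exp_add]
      _ ≤ _ := by nlinarith
  have h6 : β * (p-1) * (1 + (r+1)^2) * d^2 ≤ k / s^2 := by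
    have : d^2 = k * (k/s^2) := by rw [hd]; field_simp
    rw [this]
    have hks : 0 ≤ k / s^2 := by positivity
    nlinarith [mul_le_mul_of_nonneg_right hk3 hks]
  rw [e1, e2, e3]
  have hB : 0 < β^(p-1) := by positivity
  have h7 : β * ((p-1) * (exp (d^2) * (1+d)^r)) + β ≤ β * p * (1+d) + k/s^2 := by
    have h8 := mul_le_mul_of_nonneg_left h2 (mul_pos hβ hp1).le
    have : β * (p-1) * (1 + r*d + d^2*(1+(r+1)^2))
      = β * (p-1) + β * ((p-1)*r) * d + β * (p-1) * (1 + (r+1)^2) * d^2 := by ring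
    rw [this, hpr] at h8
    nlinarith
  have h9 := mul_le_mul_of_nonneg_left h7 hB.le
  calc _ = β ^ (p - 1) * (β * ((p-1) * (exp (d^2) * (1+d)^r)) + β) := by ring
    _ ≤ _ := h9
    _ = _ := by ring

/-- The pointwise inequality, in scaled form. -/
lemma aux_point (p β k s v x : ℝ) (hp : 1 < p) (hβ : 0 < β) (hk : 0 < k) (hk1 : k ≤ 1)
    (hk2 : (p/(p-1) + 1) * k ≤ 1) (hk3 : β * (p-1) * (1 + (p/(p-1)+1)^2) * k ≤ 1)
    (hk4 : (p-1) * k ≤ 1/2) (hs : 1 ≤ s) :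
    -((β * p * (β^(p-1) * (1 + k/s)) + β^(p-1) * k / s^2) * |v|^p
      + β^(p-1) * (1 + k/s) * (p * |v|^(p-2) * v * x))
    ≤ |x|^p - β^p * |v|^p - ((p-1)*k^2/2) * (|x|^p / s^2) := by
  have hp1 : 0 < p - 1 := by linarith
  have hs0 : 0 < s := by linarith
  set y := β^(p-1) * (1 + k/s) with hy
  have hy0 : 0 < y := by positivity
  have h1 := aux_young p (k^2/s^2) y |v| |x| hp hy0.le (abs_nonneg _) (abs_nonneg _)
  have h2 := aux_scalar p β k s hp hβ hk hk1 hk2 hk3 hs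
  rw [← hy] at h2
  have h3 : -(y * (p * |v|^(p-2) * v * x)) ≤ p * y * |v|^(p-1) * |x| := by
    have e : |v|^(p-1) = |v|^(p-2) * |v| := by
      rcases eq_or_ne v 0 with h | h
      · subst h; simp [hp1.ne']
      · rw [← Real.rpow_add_one (abs_pos.2 h).ne']; congr 1; ring
    rw [e]
    have : -(v*x) ≤ |v| * |x| := by rw [← abs_mul]; exact neg_le_abs _
    have hc : 0 ≤ y * p * |v|^(p-2) := by positivity
    nlinarith [mul_le_mul_of_nonneg_left this hc]
  have h4 : exp (-(p-1)*(k^2/s^2)) ≤ 1 - (p-1)*k^2/2/s^2 := by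
    set z := (p-1)*(k^2/s^2) with hz
    have hz0 : 0 ≤ z := by positivity
    have hz1 : z ≤ 1/2 := by
      have : k^2/s^2 ≤ k := by
        have hkk : k^2 ≤ k := by nlinarith
        have hss : 1 ≤ s^2 := by nlinarith
        exact (div_le_self (by positivity) hss).trans hkk
      nlinarith
    have h5 := (abs_le.1 (Real.abs_exp_sub_one_sub_id_le (x := -z)
      (by rw [abs_neg, abs_of_nonneg hz0]; linarith))).2
    have e1 : -(p-1)*(k^2/s^2) = -z := by rw [hz]; ring
    have e2 : (p-1)*k^2/2/s^2 = z/2 := by rw [hz]; ring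
    rw [e1, e2]
    nlinarith
  have hV : 0 ≤ |v|^p := by positivity
  have hX : 0 ≤ |x|^p := by positivity
  have h6 := mul_le_mul_of_nonneg_right h4 hX
  have h7 := mul_le_mul_of_nonneg_right h2 hV
  have e : (p-1)*k^2/2/s^2 * |x|^p = ((p-1)*k^2/2) * (|x|^p / s^2) := by ring
  nlinarith

lemma aux_int (F : ℝ → ℝ) (b : ℝ) (hb : 0 < b) (hb1 : b < 1) (h0 : ∀ t ∈ Ioc 0 b, F t = 0)
    (hc : ContinuousOn F (Icc b 1)) :
    IntegrableOn F (Icc b 1) ∧ IntegrableOn F (Ioc 0 1) ∧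
      ∫ t in Ioc (0:ℝ) 1, F t = ∫ t in b..1, F t := by
  have i1 : IntegrableOn F (Icc b 1) := hc.integrableOn_Icc
  have i2 : IntegrableOn F (Ioc 0 b) :=
    (integrableOn_zero (μ := volume)).congr_fun (fun t ht => (h0 t ht).symm) measurableSet_Ioc
  have i3 : IntegrableOn F (Ioc b 1) := i1.mono_set Ioc_subset_Icc_self
  have hu : Ioc (0:ℝ) 1 = Ioc 0 b ∪ Ioc b 1 := (Ioc_union_Ioc_eq_Ioc hb.le hb1.le).symm
  refine ⟨i1, hu ▸ i2.union i3, ?_⟩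
  rw [hu, setIntegral_union (Ioc_disjoint_Ioc_of_le le_rfl) measurableSet_Ioc i2 i3,
    setIntegral_congr_fun measurableSet_Ioc h0, intervalIntegral.integral_of_le hb1.le]
  simp

/-- Critical case `α > 1 - 1/p`: remainder involving the derivative. -/
theorem hardy_supercritical_deriv_remainder (p α R : ℝ) (hp : 1 < p) (hα : 1 - 1/p < α)
    (hR : Real.exp 1 < R) :
    ∃ C₆ > (0:ℝ), ∃ L > (0:ℝ), ∀ u : ℝ → ℝ, ContDiff ℝ (⊤ : ℕ∞) u →
      (∃ a > (0:ℝ), ∀ t < a, u t = 0) →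
      (∫ t in Ioc (0:ℝ) 1,
          (|deriv u t| ^ p - (α - 1 + 1/p) ^ p * (|u t| / t) ^ p) * t ^ (α * p))
        + L * |u 1| ^ p ≥
      C₆ * ∫ t in Ioc (0:ℝ) 1,
          |deriv u t| ^ p * t ^ (α * p) * (Real.log (R / t)) ^ (-(2:ℝ)) := by
  have hp1 : 0 < p - 1 := by linarith
  have hp0 : 0 < p := by linarith
  have hR0 : 0 < R := (exp_pos 1).trans hR
  obtain ⟨β, hβd⟩ : ∃ β, β = α - 1 + 1/p := ⟨_, rfl⟩
  rw [← hβd]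
  have hβ : 0 < β := by rw [hβd]; linarith
  have hαp : α * p = (β * p - 1) + p := by rw [hβd]; field_simp; ring
  obtain ⟨k, hk, hk1, hk2, hk3, hk4⟩ : ∃ k : ℝ, 0 < k ∧ k ≤ 1 ∧ (p/(p-1) + 1) * k ≤ 1 ∧
      β * (p-1) * (1 + (p/(p-1)+1)^2) * k ≤ 1 ∧ (p-1) * k ≤ 1/2 := by
    have hr : 0 < p/(p-1) := by positivity
    obtain ⟨r, hrr⟩ : ∃ r, r = p/(p-1) := ⟨_, rfl⟩
    rw [← hrr] at hr ⊢
    have hM : 0 < β * (p-1) * (1 + (r+1)^2) := by positivity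
    obtain ⟨M, hMM⟩ : ∃ M, M = β * (p-1) * (1 + (r+1)^2) := ⟨_, rfl⟩
    rw [← hMM] at hM ⊢
    have hD : 0 < 1 + r + M + 2 * (p-1) := by positivity
    refine ⟨1/(1 + r + M + 2*(p-1)), by positivity, ?_, ?_, ?_, ?_⟩
    · rw [div_le_iff₀ hD]; linarith
    · rw [mul_one_div, div_le_iff₀ hD]; linarith
    · rw [mul_one_div, div_le_iff₀ hD]; linarith
    · rw [mul_one_div, div_le_iff₀ hD]; linarith
  have hlog : ∀ t ∈ Ioc (0:ℝ) 1, 1 ≤ log (R/t) := by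
    intro t ht
    rw [Real.le_log_iff_exp_le (div_pos hR0 ht.1), le_div_iff₀ ht.1]
    nlinarith [ht.2, exp_pos 1]
  have hlogR : 0 < log (R/1) := lt_of_lt_of_le one_pos (hlog 1 (by simp))
  refine ⟨(p-1)*k^2/2, by positivity, β^(p-1) * (1 + k/log (R/1)), by positivity, ?_⟩
  rintro u hu ⟨a, ha, hua⟩
  have hud : Differentiable ℝ u := hu.differentiable (by simp)
  have hudc : Continuous (deriv u) := hu.continuous_deriv (by simp)
  have hda : ∀ t < a, deriv u t = 0 := by
    intro t ht
    have : u =ᶠ[nhds t] fun _ => 0 := by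
      filter_upwards [Iio_mem_nhds ht] with x hx using hua x hx
    rw [this.deriv_eq]; simp
  obtain ⟨b, hb, hb1, hba⟩ : ∃ b, 0 < b ∧ b < 1 ∧ b < a :=
    ⟨min a 1 / 2, by positivity, by linarith [min_le_right a 1],
      by linarith [min_le_left a 1]⟩
  have hpos : ∀ t ∈ Icc b 1, t ∈ Ioc (0:ℝ) 1 := fun t ht => ⟨hb.trans_le ht.1, ht.2⟩
  have hclog : ContinuousOn (fun t => log (R/t)) (Icc b 1) := by
    apply ContinuousOn.log
    · exact continuousOn_const.div continuousOn_id (fun t ht => (hpos t ht).1.ne')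
    · intro t ht; exact (div_pos hR0 (hpos t ht).1).ne'
  have hct : ∀ e : ℝ, ContinuousOn (fun t : ℝ => t^e) (Icc b 1) := fun e =>
    continuousOn_id.rpow_const (fun t ht => Or.inl (hpos t ht).1.ne')
  have hcdu : ContinuousOn (fun t => |deriv u t|^p) (Icc b 1) :=
    (hudc.abs.rpow_const (fun _ => Or.inr hp0.le)).continuousOn
  have hcu : ContinuousOn (fun t => (|u t|/t)^p) (Icc b 1) := by
    apply ContinuousOn.rpow_const
    · exact hud.continuous.abs.continuousOn.div continuousOn_id
        (fun t ht => (hpos t ht).1.ne')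
    · intro t ht; exact Or.inr hp0.le
  obtain ⟨f1, f2, f3⟩ := aux_int
    (fun t => (|deriv u t| ^ p - β ^ p * (|u t| / t) ^ p) * t ^ (α * p)) b hb hb1
    (by
      intro t ht
      have : t < a := ht.2.trans_lt hba
      simp [hda t this, hua t this, Real.zero_rpow hp0.ne'])
    ((hcdu.sub (continuousOn_const.mul hcu)).mul (hct _))
  obtain ⟨g1, g2, g3⟩ := aux_int
    (fun t => |deriv u t| ^ p * t ^ (α * p) * (Real.log (R / t)) ^ (-(2:ℝ))) b hb hb1
    (by
      intro t ht
      have : t < a := ht.2.trans_lt hba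
      simp [hda t this, Real.zero_rpow hp0.ne'])
    ((hcdu.mul (hct _)).mul (hclog.rpow_const
      (fun t ht => Or.inl (by linarith [hlog t (hpos t ht)]))))
  rw [f3, g3]
  have hderiv : ∀ t ∈ Icc b 1, HasDerivAt
      (fun t => -(t^(β*p) * (β^(p-1) * (1 + k / log (R/t))) * |u t|^p))
      (t^(β*p-1) * -((β * p * (β^(p-1) * (1 + k/log (R/t))) + β^(p-1) * k / (log (R/t))^2) * |u t|^p
      + β^(p-1) * (1 + k/log (R/t)) * (p * |u t|^(p-2) * u t * (t * deriv u t)))) t := by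
    intro t ht
    have ht0 : 0 < t := (hpos t ht).1
    have hl := hlog t (hpos t ht)
    have hl0 : log (R/t) ≠ 0 := by linarith
    have d1 : HasDerivAt (fun t : ℝ => t^(β*p)) (β*p * t^(β*p-1)) t :=
      Real.hasDerivAt_rpow_const (Or.inl ht0.ne')
    have d2 : HasDerivAt (fun t : ℝ => log (R/t)) (-1/t) t := by
      have h := ((hasDerivAt_inv ht0.ne').const_mul R).log (by positivity)
      refine (h.congr_deriv (by field_simp)).congr_of_eventuallyEq (.of_forall fun x => ?_)
      simp only [div_eq_mul_inv]
    have d3 : HasDerivAt (fun t : ℝ => β^(p-1) * (1 + k / log (R/t)))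
        (β^(p-1) * (k / (log (R/t))^2 / t)) t := by
      have h := (((d2.inv hl0).const_mul k).const_add 1).const_mul (β^(p-1))
      refine (h.congr_deriv (by field_simp)).congr_of_eventuallyEq (.of_forall fun x => ?_)
      simp [div_eq_mul_inv]
    have d4 : HasDerivAt (fun t => |u t|^p) (p * |u t|^(p-2) * u t * deriv u t) t :=
      (hasDerivAt_abs_rpow (u t) hp).comp t (hud t).hasDerivAt
    have h := ((d1.mul d3).mul d4).neg
    have e : t^(β*p) = t^(β*p-1) * t := by
      rw [← Real.rpow_add_one ht0.ne']; congr 1; ring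
    refine (h.congr_deriv ?_).congr_of_eventuallyEq (.of_forall fun x => by simp)
    simp only [Pi.mul_apply]
    rw [e]
    field_simp
  have hi := intervalIntegral.sub_le_integral_of_hasDeriv_right_of_le hb1.le
    (fun t ht => (hderiv t ht).continuousAt.continuousWithinAt)
    (fun t ht => (hderiv t (Ioo_subset_Icc_self ht)).hasDerivWithinAt)
    (f1.sub (g1.const_mul ((p-1)*k^2/2)))
    (by
      intro t ht
      have ht' := hpos t (Ioo_subset_Icc_self ht)
      have ht0 : 0 < t := ht'.1
      have hl := hlog t ht'
      have h := aux_point p β k (log (R/t)) (u t) (t * deriv u t) hp hβ hk hk1 hk2 hk3 hk4 hl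
      have h2 := mul_le_mul_of_nonneg_left h (Real.rpow_nonneg ht0.le (β*p-1))
      refine h2.trans (le_of_eq ?_)
      have e1 : t^(α*p) = t^(β*p-1) * t^p := by rw [hαp, Real.rpow_add ht0]
      have e2 : (log (R/t)) ^ (-(2:ℝ)) = ((log (R/t))^2)⁻¹ := by
        rw [Real.rpow_neg (by linarith)]; norm_num
      have e3 : |t * deriv u t|^p = t^p * |deriv u t|^p := by
        rw [abs_mul, abs_of_pos ht0, Real.mul_rpow ht0.le (abs_nonneg _)]
      have e4 : (|u t|/t)^p * t^p = |u t|^p := by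
        rw [← Real.mul_rpow (by positivity) ht0.le]; congr 1; field_simp
      simp only [Pi.sub_apply]
      rw [e1, e2, e3, ← e4]
      ring)
  have hub : u b = 0 := hua b hba
  have ii1 := (intervalIntegrable_iff_integrableOn_Icc_of_le hb1.le (μ := volume)).2 f1
  have ii2 := (intervalIntegrable_iff_integrableOn_Icc_of_le hb1.le (μ := volume)).2 g1
  simp only [Pi.sub_apply] at hi
  rw [intervalIntegral.integral_sub ii1 (ii2.const_mul _),
    intervalIntegral.integral_const_mul, hub, Real.one_rpow] at hi
  simp only [abs_zero, Real.zero_rpow hp0.ne', mul_zero, neg_zero, sub_zero, one_mul] at hi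
  linarith
end

section
/- Let α < 1 - 1/p, 1 < p < ∞, R > e. There exist positive constants C₀, C₁, L such that for every u ∈ C_c^∞((0,1]): ∫₀¹ (|u'|^p − |u/t|^p (Λ_{α,p} + C₀/A₁(t)²)) t^{αp} dt ≥ C₁ ∫₀¹ (|u'|^p + |u/t|^p (Λ_{α,p} + C₀/A₁(t)²)) t^{αp+1} dt + L|u(1)|^p. -/
open MeasureTheory Real Set

lemma hardy_aux_young (p a b x : ℝ) (hp : 1 < p) (ha : 0 ≤ a) (hb : 0 ≤ b) (hx : 0 < x)
    (hx1 : x ≤ 1) :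
    p * x * b ^ (p - 1) * (a - b) + (1 - p / (p - 1) * (1 - x) ^ 2) * b ^ p ≤ a ^ p := by
  have hp1 : 0 < p - 1 := by linarith
  have hq : p.HolderConjugate (p / (p - 1)) := Real.HolderConjugate.conjExponent hp
  have hbp : b ^ p = b ^ (p - 1) * b := by
    rcases hb.eq_or_lt with h | h
    · rw [← h, Real.zero_rpow (by linarith)]; simp
    · rw [← Real.rpow_add_one h.ne']; ring_nf
  have hY := Real.young_inequality_of_nonneg ha
    (mul_nonneg hx.le (Real.rpow_nonneg hb (p - 1))) hq
  have hxq : (x * b ^ (p - 1)) ^ (p / (p - 1)) = x ^ (p / (p - 1)) * b ^ p := by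
    rw [Real.mul_rpow hx.le (Real.rpow_nonneg hb _), ← Real.rpow_mul hb]
    congr 2; field_simp
  rw [hxq] at hY
  have hxr : x ^ (p / (p - 1)) = x * x ^ (1 / (p - 1)) := by
    rw [mul_comm, ← Real.rpow_add_one hx.ne']; congr 1; field_simp; ring
  have hkey : (p - 1) * x ^ (p / (p - 1)) ≤ p * x - 1 + p / (p - 1) * (1 - x) ^ 2 := by
    set r := 1 / (p - 1) with hr
    have hr0 : 0 < r := by positivity
    have h1 : 1 + r * (1 - x) ≤ (x ^ r)⁻¹ := by
      rw [← Real.rpow_neg hx.le, Real.rpow_def_of_pos hx]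
      have := Real.add_one_le_exp (Real.log x * -r)
      have h2 := Real.log_le_sub_one_of_pos hx
      nlinarith
    have hd : 0 < 1 + r * (1 - x) := by nlinarith
    have h2 : x ^ r * (1 + r * (1 - x)) ≤ 1 := by
      have h3 : 0 < x ^ r := Real.rpow_pos_of_pos hx r
      calc x ^ r * (1 + r * (1 - x)) ≤ x ^ r * (x ^ r)⁻¹ := by gcongr
        _ = 1 := mul_inv_cancel₀ h3.ne'
    have hrp : r * (p - 1) = 1 := by rw [hr]; field_simp
    have hpr : p / (p - 1) = p * r := by rw [hr]; ring
    rw [hxr, hpr]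
    have h4 : (p - 1) * (x * x ^ r) * (1 + r * (1 - x)) ≤ (p - 1) * x := by
      have := mul_le_mul_of_nonneg_left h2 (mul_pos hp1 hx).le
      nlinarith
    have h5 : (p - 1) * x ≤ (p * x - 1 + p * r * (1 - x) ^ 2) * (1 + r * (1 - x)) := by
      have : (p * x - 1 + p * r * (1 - x) ^ 2) * (1 + r * (1 - x)) - (p - 1) * x
          = p * r ^ 2 * (1 - x) ^ 3 + (r * (p - 1) - 1) * (1 - x) := by ring
      have h6 : 0 ≤ p * r ^ 2 * (1 - x) ^ 3 := by
        have : 0 ≤ 1 - x := by linarith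
        positivity
      rw [hrp] at this
      linarith
    exact le_of_mul_le_mul_right (h4.trans h5) hd
  have hbp0 : 0 ≤ b ^ p := Real.rpow_nonneg hb p
  have hk2 := mul_le_mul_of_nonneg_right hkey hbp0
  have hY2 : p * (a * (x * b ^ (p - 1))) ≤ a ^ p + (p - 1) * x ^ (p / (p - 1)) * b ^ p := by
    have := mul_le_mul_of_nonneg_left hY (by linarith : 0 ≤ p)
    calc _ ≤ _ := this
      _ = _ := by field_simp
  have e : p * x * b ^ (p - 1) * (a - b) = p * (a * (x * b ^ (p - 1))) - p * x * b ^ p := by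
    rw [hbp]; ring
  rw [e]
  linarith

lemma hardy_aux_young2 (p a b c s : ℝ) (hp : 1 < p) (ha : 0 ≤ a) (hb : 0 ≤ b) (hs : 0 < s)
    (hsc : s ≤ c) (hc : 1 / 2 ≤ c) :
    p * s * b ^ (p - 1) * (a - b) + (c - 2 * (p / (p - 1)) * (c - s) ^ 2) * b ^ p
      ≤ c * a ^ p := by
  have hc0 : 0 < c := by linarith
  have h := hardy_aux_young p a b (s / c) hp ha hb (by positivity) ((div_le_one hc0).2 hsc)
  have h2 := mul_le_mul_of_nonneg_left h hc0.le
  have hM : 0 ≤ p / (p - 1) := div_nonneg (by linarith) (by linarith)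
  have hbp0 : 0 ≤ b ^ p := Real.rpow_nonneg hb p
  have e : c * (p * (s / c) * b ^ (p - 1) * (a - b) + (1 - p / (p - 1) * (1 - s / c) ^ 2) * b ^ p)
      = p * s * b ^ (p - 1) * (a - b) + (c - p / (p - 1) * ((c - s) ^ 2 / c)) * b ^ p := by
    have : (1 - s / c) ^ 2 = (c - s) ^ 2 / c ^ 2 := by field_simp
    rw [this]; field_simp
  rw [e] at h2
  refine le_trans ?_ h2
  have h3 : (c - s) ^ 2 / c ≤ 2 * (c - s) ^ 2 := by
    rw [div_le_iff₀ hc0]; nlinarith [sq_nonneg (c - s)]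
  have h4 := mul_le_mul_of_nonneg_left h3 hM
  have h5 : c - 2 * (p / (p - 1)) * (c - s) ^ 2 ≤ c - p / (p - 1) * ((c - s) ^ 2 / c) := by
    linarith
  have := mul_le_mul_of_nonneg_right h5 hbp0
  linarith

/-- The coefficient inequality combined with Young: everything at a fixed point `t`. -/
lemma hardy_aux_point (p g ε C₁ t A a B : ℝ) (hp : 1 < p) (hg : 0 < g) (hε : 0 < ε)
    (hε8 : ε ≤ 1 / 8) (hεM : 8 * (p / (p - 1)) * g * ε ≤ 1 / 2)
    (hC : C₁ = ε / (4 * (g + 1))) (ht : 0 < t) (ht1 : t ≤ 1) (hA : 1 ≤ A)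
    (ha : 0 ≤ a) (hB : 0 ≤ B) :
    g ^ (p - 1) * ((-(ε / A ^ 2) - ε * t) * B ^ p
        - p * g * (1 - ε / A - ε * t) * B ^ p + p * (1 - ε / A - ε * t) * B ^ (p - 1) * a)
      ≤ (1 - C₁ * t) * a ^ p
        - (1 + C₁ * t) * (B ^ p * (g ^ p + g ^ (p - 1) * (ε / 4) / A ^ 2)) := by
  have hC0 : 0 < C₁ := by rw [hC]; positivity
  have hCg : C₁ * (4 * (g + 1)) = ε := by rw [hC]; field_simp
  have hCε : C₁ ≤ ε / 4 := by nlinarith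
  obtain ⟨i, hi⟩ : ∃ i, i = 1 / A := ⟨_, rfl⟩
  have hi0 : 0 < i := by rw [hi]; positivity
  have hi1 : i ≤ 1 := by rw [hi]; exact (div_le_one (by linarith)).2 hA
  have e1 : ε / A = ε * i := by rw [hi]; ring
  have e2 : ε / A ^ 2 = ε * i ^ 2 := by rw [hi]; field_simp
  have e3 : g ^ (p - 1) * (ε / 4) / A ^ 2 = g ^ (p - 1) * (ε / 4) * i ^ 2 := by
    rw [hi]; field_simp
  rw [e1, e2, e3]
  have hei : ε * i ≤ 1 / 8 := by nlinarith
  have het : ε * t ≤ 1 / 8 := by nlinarith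
  have hCt : C₁ * t ≤ ε * t := by nlinarith
  have hCt1 : C₁ * t ≤ 1 / 32 := by nlinarith
  have hCt0 : 0 < C₁ * t := by positivity
  have hei0 : 0 < ε * i := by positivity
  have hY := hardy_aux_young2 p a (g * B) (1 - C₁ * t) (1 - ε * i - ε * t) hp ha (by positivity)
    (by linarith) (by linarith) (by linarith)
  rw [Real.mul_rpow hg.le hB, Real.mul_rpow hg.le hB] at hY
  have hgp : g ^ p = g ^ (p - 1) * g := by
    rw [← Real.rpow_add_one hg.ne']; ring_nf
  have hBp : B ^ p = B ^ (p - 1) * B := by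
    rcases hB.eq_or_lt with h | h
    · rw [← h, Real.zero_rpow (by linarith)]; simp
    · rw [← Real.rpow_add_one h.ne']; ring_nf
  have hG : 0 < g ^ (p - 1) := Real.rpow_pos_of_pos hg _
  have hM : 0 ≤ p / (p - 1) := div_nonneg (by linarith) (by linarith)
  set G := g ^ (p - 1)
  set M := p / (p - 1)
  set D := B ^ (p - 1)
  have hD : 0 ≤ D := Real.rpow_nonneg hB _
  have hd2 : (1 - C₁ * t - (1 - ε * i - ε * t)) ^ 2 ≤ 2 * ε ^ 2 * i ^ 2 + 2 * ε ^ 2 * t := by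
    have h1 : (1 - C₁ * t - (1 - ε * i - ε * t)) ^ 2 ≤ (ε * i + ε * t) ^ 2 := by
      apply pow_le_pow_left₀ <;> linarith
    have h2 : (ε * i + ε * t) ^ 2 ≤ 2 * ε ^ 2 * i ^ 2 + 2 * ε ^ 2 * t ^ 2 := by
      linarith [sq_nonneg (ε * i - ε * t)]
    have h3 : ε ^ 2 * t ^ 2 ≤ ε ^ 2 * t := by
      have : t ^ 2 ≤ t := by
        rw [sq]; exact mul_le_of_le_one_right ht.le ht1
      gcongr
    linarith
  have hcoef : 2 * g * (C₁ * t) + 2 * M * g * (1 - C₁ * t - (1 - ε * i - ε * t)) ^ 2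
      + (1 + C₁ * t) * (ε / 4 * i ^ 2) ≤ ε * i ^ 2 + ε * t := by
    have h1 : 2 * M * g * (1 - C₁ * t - (1 - ε * i - ε * t)) ^ 2
        ≤ 2 * M * g * (2 * ε ^ 2 * i ^ 2 + 2 * ε ^ 2 * t) := by gcongr
    have h2 : 2 * M * g * (2 * ε ^ 2 * i ^ 2 + 2 * ε ^ 2 * t)
        ≤ 1 / 4 * (ε * (i ^ 2 + t)) := by
      have : 0 ≤ ε * (i ^ 2 + t) := by positivity
      have h := mul_le_mul_of_nonneg_right hεM this
      linarith
    have h3 : 2 * g * (C₁ * t) ≤ ε / 2 * t := by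
      have : 2 * g * C₁ ≤ ε / 2 := by linarith
      have := mul_le_mul_of_nonneg_right this ht.le
      linarith
    have h4 : (1 + C₁ * t) * (ε / 4 * i ^ 2) ≤ 2 * (ε / 4 * i ^ 2) := by
      gcongr; linarith
    linarith [mul_pos hε (pow_pos hi0 2), mul_pos hε ht]
  have hk := mul_le_mul_of_nonneg_left hcoef
    (mul_nonneg hG.le (mul_nonneg hD hB))
  rw [hgp, hBp] at hY ⊢
  linear_combination hY + hk

/-- Theorem 2.1: noncritical weighted Hardy inequality with sharp remainders. -/
theorem hardy_noncritical_sharp (p α R : ℝ) (hp : 1 < p) (hα : α < 1 - 1/p)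
    (hR : Real.exp 1 < R) :
    ∃ C₀ > (0:ℝ), ∃ C₁ > (0:ℝ), ∃ L > (0:ℝ), ∀ u : ℝ → ℝ, ContDiff ℝ (⊤ : ℕ∞) u →
      (∃ a > (0:ℝ), ∀ t < a, u t = 0) →
      ∫ t in Ioc (0:ℝ) 1,
          (|deriv u t| ^ p
            - (|u t| / t) ^ p * ((1 - 1/p - α) ^ p + C₀ / (Real.log (R / t)) ^ 2))
            * t ^ (α * p) ≥
        C₁ * (∫ t in Ioc (0:ℝ) 1,
            (|deriv u t| ^ p
              + (|u t| / t) ^ p * ((1 - 1/p - α) ^ p + C₀ / (Real.log (R / t)) ^ 2))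
              * t ^ (α * p + 1))
          + L * |u 1| ^ p := by
  obtain ⟨g, hgdef⟩ : ∃ g, g = 1 - 1/p - α := ⟨_, rfl⟩
  have hg : 0 < g := by rw [hgdef]; linarith
  rw [← hgdef]
  have hp0 : 0 < p := by linarith
  have hgp : p * g = p - 1 - α * p := by rw [hgdef]; field_simp
  have hp1 : 0 < p - 1 := by linarith
  obtain ⟨ε, hε, hε8, hεM⟩ : ∃ ε : ℝ, 0 < ε ∧ ε ≤ 1 / 8 ∧ 8 * (p / (p - 1)) * g * ε ≤ 1 / 2 := by
    refine ⟨min (1 / 8) (1 / 2 / (8 * (p / (p - 1)) * g)), by positivity, min_le_left _ _, ?_⟩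
    have hk : 0 < 8 * (p / (p - 1)) * g := by positivity
    rw [mul_comm, ← le_div_iff₀ hk]
    exact min_le_right _ _
  have hR0 : 0 < R := (Real.exp_pos 1).trans hR
  have hAge : ∀ t : ℝ, 0 < t → t ≤ 1 → 1 ≤ Real.log (R / t) := by
    intro t ht ht1
    rw [Real.le_log_iff_exp_le (by positivity), le_div_iff₀ ht]
    nlinarith [Real.exp_pos 1]
  have hG : 0 < g ^ (p - 1) := Real.rpow_pos_of_pos hg _
  have hA1 := hAge 1 one_pos le_rfl
  have hs1 : 0 < 1 - ε / Real.log (R / 1) - ε * 1 := by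
    have : ε / Real.log (R / 1) ≤ ε := div_le_self hε.le hA1
    linarith
  refine ⟨g ^ (p - 1) * (ε / 4), by positivity, ε / (4 * (g + 1)), by positivity,
    g ^ (p - 1) * (1 - ε / Real.log (R / 1) - ε * 1), by positivity, ?_⟩
  intro u hu ⟨a₀, ha₀, hua⟩
  obtain ⟨C₁, hC⟩ : ∃ C₁, C₁ = ε / (4 * (g + 1)) := ⟨_, rfl⟩
  rw [← hC]
  obtain ⟨b, hb0, hb1, hba⟩ : ∃ b : ℝ, 0 < b ∧ b < 1 ∧ b < a₀ := by
    refine ⟨min (1 / 2) (a₀ / 2), by positivity, ?_, ?_⟩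
    · exact (min_le_left _ _).trans_lt (by norm_num)
    · exact (min_le_right _ _).trans_lt (by linarith)
  have hdu : ∀ t < a₀, deriv u t = 0 := by
    intro t ht
    have : u =ᶠ[nhds t] fun _ => (0:ℝ) := by
      filter_upwards [Iio_mem_nhds ht] with y hy using hua y hy
    rw [this.deriv_eq]; simp
  have hucont : Continuous u := hu.continuous
  have hducont : Continuous (deriv u) := hu.continuous_deriv (by simp)
  have hudiff : Differentiable ℝ u := hu.differentiable (by simp)
  set F1 : ℝ → ℝ := fun t => (|deriv u t| ^ p
            - (|u t| / t) ^ p * (g ^ p + g ^ (p - 1) * (ε / 4) / (Real.log (R / t)) ^ 2))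
            * t ^ (α * p) with hF1
  set F2 : ℝ → ℝ := fun t => (|deriv u t| ^ p
            + (|u t| / t) ^ p * (g ^ p + g ^ (p - 1) * (ε / 4) / (Real.log (R / t)) ^ 2))
            * t ^ (α * p + 1) with hF2
  have hne : ∀ t ∈ Icc b 1, t ≠ 0 := fun t ht => (hb0.trans_le ht.1).ne'
  have hlogc : ContinuousOn (fun t => Real.log (R / t)) (Icc b 1) := by
    refine ContinuousOn.log (continuousOn_const.div continuousOn_id hne) ?_
    intro t ht
    exact div_ne_zero hR0.ne' (hne t ht)
  have hlogne : ∀ t ∈ Icc b 1, Real.log (R / t) ≠ 0 := by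
    intro t ht
    have := hAge t (hb0.trans_le ht.1) ht.2
    linarith
  have hdup : ContinuousOn (fun t => |deriv u t| ^ p) (Icc b 1) :=
    (hducont.abs.rpow_const (fun _ => Or.inr hp0.le)).continuousOn
  have hutp : ContinuousOn (fun t => (|u t| / t) ^ p) (Icc b 1) :=
    (hucont.abs.continuousOn.div continuousOn_id hne).rpow_const (fun _ _ => Or.inr hp0.le)
  have hcoefc : ContinuousOn (fun t => g ^ p + g ^ (p - 1) * (ε / 4) / (Real.log (R / t)) ^ 2)
      (Icc b 1) :=
    continuousOn_const.add (continuousOn_const.div (hlogc.pow 2)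
      (fun t ht => pow_ne_zero 2 (hlogne t ht)))
  have htc : ∀ r : ℝ, ContinuousOn (fun t : ℝ => t ^ r) (Icc b 1) := fun r =>
    continuousOn_id.rpow_const (fun t ht => Or.inl (hne t ht))
  have hF1c : ContinuousOn F1 (Icc b 1) := (hdup.sub (hutp.mul hcoefc)).mul (htc _)
  have hF2c : ContinuousOn F2 (Icc b 1) := (hdup.add (hutp.mul hcoefc)).mul (htc _)
  have hF1i : IntegrableOn F1 (Icc b 1) := hF1c.integrableOn_Icc
  have hF2i : IntegrableOn F2 (Icc b 1) := hF2c.integrableOn_Icc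
  have hsub : Ioc b 1 ⊆ Ioc 0 1 := Ioc_subset_Ioc_left hb0.le
  have hlow : ∀ t ∈ Ioc (0:ℝ) 1 \ Ioc b 1, t < a₀ := by
    rintro t ⟨h1, h2⟩
    by_contra h
    exact h2 ⟨by linarith, h1.2⟩
  have hI1 : ∫ t in Ioc (0:ℝ) 1, F1 t = ∫ t in Ioc b 1, F1 t := by
    refine setIntegral_eq_of_subset_of_forall_sdiff_eq_zero measurableSet_Ioc hsub ?_
    intro t ht
    simp [hF1, hua t (hlow t ht), hdu t (hlow t ht), Real.zero_rpow hp0.ne']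
  have hI2 : ∫ t in Ioc (0:ℝ) 1, F2 t = ∫ t in Ioc b 1, F2 t := by
    refine setIntegral_eq_of_subset_of_forall_sdiff_eq_zero measurableSet_Ioc hsub ?_
    intro t ht
    simp [hF2, hua t (hlow t ht), hdu t (hlow t ht), Real.zero_rpow hp0.ne']
  rw [hI1, hI2, ge_iff_le, ← le_sub_iff_add_le', ← integral_const_mul,
    ← integral_sub (hF1i.mono_set Ioc_subset_Icc_self)
      ((hF2i.mono_set Ioc_subset_Icc_self).const_mul C₁),
    ← intervalIntegral.integral_of_le hb1.le]
  set W : ℝ → ℝ := fun t => g ^ (p - 1) *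
    ((1 - ε / Real.log (R / t) - ε * t) * t ^ (-(p * g)) * |u t| ^ p) with hW
  have hW1 : W 1 - W b = g ^ (p - 1) * (1 - ε / Real.log (R / 1) - ε * 1) * |u 1| ^ p := by
    simp only [hW, hua b hba, abs_zero, Real.zero_rpow hp0.ne', Real.one_rpow]
    ring
  rw [← hW1]
  have hWd : ∀ t ∈ Icc b 1, HasDerivAt W (g ^ (p - 1) *
      (((-(ε / Real.log (R / t) ^ 2 / t) - ε) * t ^ (-(p * g))
        + (1 - ε / Real.log (R / t) - ε * t) * (-(p * g) * t ^ (-(p * g) - 1))) * |u t| ^ p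
        + (1 - ε / Real.log (R / t) - ε * t) * t ^ (-(p * g))
          * (p * |u t| ^ (p - 2) * u t * deriv u t))) t := by
    intro t ht
    have ht0 := hne t ht
    have hl0 := hlogne t ht
    have d1 : HasDerivAt (fun t => Real.log (R / t)) (-(1 / t)) t := by
      have := (((hasDerivAt_id t).fun_inv ht0).const_mul R).log
        (mul_ne_zero hR0.ne' (inv_ne_zero ht0))
      simp only [id] at this
      refine HasDerivAt.congr_deriv (f' := R * (-1 / t ^ 2) / (R * t⁻¹)) ?_ ?_
      · simpa only [div_eq_mul_inv R] using this
      · field_simp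
    have d2 : HasDerivAt (fun t => 1 - ε / Real.log (R / t) - ε * t)
        (-(ε / Real.log (R / t) ^ 2 / t) - ε) t := by
      have := (((d1.fun_inv hl0).const_mul ε).const_sub 1).sub ((hasDerivAt_id t).const_mul ε)
      refine HasDerivAt.congr_deriv (f' := -(ε * (-(-(1 / t)) / Real.log (R / t) ^ 2)) - ε * 1)
        ?_ ?_
      · simp only [div_eq_mul_inv ε]
        exact this
      · field_simp
    have d3 : HasDerivAt (fun t : ℝ => t ^ (-(p * g))) (-(p * g) * t ^ (-(p * g) - 1)) t :=
      Real.hasDerivAt_rpow_const (Or.inl ht0)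
    have d4 : HasDerivAt (fun t => |u t| ^ p) (p * |u t| ^ (p - 2) * u t * deriv u t) t :=
      (hasDerivAt_abs_rpow (u t) hp).comp t (hudiff t).hasDerivAt
    exact ((d2.mul d3).mul d4).const_mul _
  refine intervalIntegral.sub_le_integral_of_hasDeriv_right_of_le hb1.le
    (fun t ht => (hWd t ht).continuousAt.continuousWithinAt)
    (fun t ht => (hWd t (Ioo_subset_Icc_self ht)).hasDerivWithinAt)
    (hF1i.sub (hF2i.const_mul C₁)) ?_
  intro t ht
  have ht0 : 0 < t := hb0.trans ht.1
  have hA := hAge t ht0 ht.2.le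
  have hpt := hardy_aux_point p g ε C₁ t (Real.log (R / t)) |deriv u t| (|u t| / t) hp hg hε hε8
    hεM hC ht0 ht.2.le hA (abs_nonneg _) (by positivity)
  have hT : 0 < t ^ (α * p) := Real.rpow_pos_of_pos ht0 _
  have hpt2 := mul_le_mul_of_nonneg_right hpt hT.le
  have hR1 : F1 t - C₁ * F2 t = ((1 - C₁ * t) * |deriv u t| ^ p
        - (1 + C₁ * t) * ((|u t| / t) ^ p *
          (g ^ p + g ^ (p - 1) * (ε / 4) / Real.log (R / t) ^ 2))) * t ^ (α * p) := by
    simp only [hF1, hF2, Real.rpow_add_one ht0.ne']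
    ring
  change _ ≤ F1 t - C₁ * F2 t
  rw [hR1]
  refine le_trans ?_ hpt2
  have hs : 0 ≤ 1 - ε / Real.log (R / t) - ε * t := by
    have h1 : ε / Real.log (R / t) ≤ ε := div_le_self hε.le hA
    have h2 : ε * t ≤ ε := mul_le_of_le_one_right hε.le ht.2.le
    linarith
  -- power identities
  have hB1 : (|u t| / t) ^ p * t ^ (α * p) = t ^ (-(p * g) - 1) * |u t| ^ p := by
    have : -(p * g) - 1 = α * p - p := by rw [hgp]; ring
    rw [this, Real.div_rpow (abs_nonneg _) ht0.le, Real.rpow_sub ht0]; ring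
  have hB2 : (|u t| / t) ^ (p - 1) * t ^ (α * p) = t ^ (-(p * g)) * |u t| ^ (p - 1) := by
    have : -(p * g) = α * p - (p - 1) := by rw [hgp]; ring
    rw [this, Real.div_rpow (abs_nonneg _) ht0.le, Real.rpow_sub ht0 (α * p) (p - 1)]; ring
  have hB3 : t ^ (-(p * g)) = t ^ (-(p * g) - 1) * t := by
    rw [← Real.rpow_add_one ht0.ne']; ring_nf
  have hU : |u t| ^ (p - 2) * u t * deriv u t ≤ |u t| ^ (p - 1) * |deriv u t| := by
    have h1 : |u t| ^ (p - 2) * |u t| = |u t| ^ (p - 1) ∨ u t = 0 := by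
      by_cases h : u t = 0
      · exact Or.inr h
      · left; rw [← Real.rpow_add_one (abs_ne_zero.2 h)]; ring_nf
    rcases h1 with h1 | h1
    · rw [← h1, mul_assoc, mul_assoc, ← abs_mul]
      exact mul_le_mul_of_nonneg_left (le_abs_self _) (Real.rpow_nonneg (abs_nonneg _) _)
    · rw [h1]; simp only [mul_zero, zero_mul]; positivity
  rw [mul_assoc (g ^ (p - 1))]
  refine mul_le_mul_of_nonneg_left ?_ hG.le
  have hU2 := mul_le_mul_of_nonneg_left hU
    (mul_nonneg hp0.le (mul_nonneg hs (Real.rpow_nonneg ht0.le (-(p * g)))))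
  have hB4 : (ε / Real.log (R / t) ^ 2 / t) * t ^ (-(p * g))
      = (ε / Real.log (R / t) ^ 2) * t ^ (-(p * g) - 1) := by
    rw [hB3]; field_simp
  set l := Real.log (R / t)
  set s := 1 - ε / l - ε * t
  have eL : ((-(ε / l ^ 2 / t) - ε) * t ^ (-(p * g))
        + s * (-(p * g) * t ^ (-(p * g) - 1))) * |u t| ^ p
        + s * t ^ (-(p * g)) * (p * |u t| ^ (p - 2) * u t * deriv u t)
      = (-(ε / l ^ 2) - ε * t) * (t ^ (-(p * g) - 1) * |u t| ^ p)
        - p * g * s * (t ^ (-(p * g) - 1) * |u t| ^ p)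
        + p * (s * t ^ (-(p * g))) * (|u t| ^ (p - 2) * u t * deriv u t) := by
    linear_combination (-|u t| ^ p) * hB4 - ε * |u t| ^ p * hB3
  have eR : ((-(ε / l ^ 2) - ε * t) * (|u t| / t) ^ p - p * g * s * (|u t| / t) ^ p
        + p * s * (|u t| / t) ^ (p - 1) * |deriv u t|) * t ^ (α * p)
      = (-(ε / l ^ 2) - ε * t) * (t ^ (-(p * g) - 1) * |u t| ^ p)
        - p * g * s * (t ^ (-(p * g) - 1) * |u t| ^ p)
        + p * (s * t ^ (-(p * g))) * (|u t| ^ (p - 1) * |deriv u t|) := by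
    linear_combination (-(ε / l ^ 2) - ε * t - p * g * s) * hB1 + p * s * |deriv u t| * hB2
  rw [eL, eR]
  linarith
end

section
/- Let α = 1 - 1/p, 1 < p < ∞, R > e^e. There exist positive constants C₀, C₁, L such that for every u ∈ C_c^∞((0,1]): ∫₀¹ (|u'|^p − |u/t|^p A₁(t)^{-p}(Λ_{α,p} + C₀/A₂(t)²)) t^{p-1} dt + L|u(1)|^p ≥ C₁ ∫₀¹ (|u'|^p + |u/t|^p A₁(t)^{-p}(Λ_{α,p} + C₀/A₂(t)²)) t^p dt. -/
open MeasureTheory Real Set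

lemma hcs_F (p : ℝ) (hp : 1 < p) : ∃ K > (0:ℝ), ∃ d > (0:ℝ), ∀ x : ℝ, 0 ≤ x → x ≤ d →
    (1-1/p)^p - K * x^2 ≤ (p-1) * (((1-1/p)^(p-1) + x) - ((1-1/p)^(p-1) + x)^(p/(p-1))) := by
  have hp0 : 0 < p := by linarith
  have ha : 0 < 1 - 1/p := by
    rw [sub_pos, div_lt_one hp0]; exact hp
  set c := (1-1/p)^(p-1) with hc
  have hcpos : 0 < c := rpow_pos_of_pos ha _
  have hp1 : 0 < p - 1 := by linarith
  have hder := (Real.hasDerivAt_rpow_const (x := c) (p := 1/(p-1)) (Or.inl hcpos.ne')).isBigO_sub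
  obtain ⟨K, hK⟩ := hder.bound
  obtain ⟨e, he, hball⟩ := Metric.eventually_nhds_iff.1 hK
  have hcr : c ^ (1/(p-1)) = 1 - 1/p := by
    rw [hc, ← rpow_mul ha.le, mul_one_div_cancel hp1.ne', rpow_one]
  have hcq : c ^ (p/(p-1)) = (1-1/p)^p := by
    rw [hc, ← rpow_mul ha.le]; congr 1; field_simp
  have hΛ : (1-1/p)^p = c * (1-1/p) := by
    rw [hc, ← rpow_add_one ha.ne']; congr 1; ring
  refine ⟨p * |K| + 1, by positivity, e/2, by positivity, ?_⟩
  intro x hx hxe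
  have h1 := hball (y := c + x) (by rw [Real.dist_eq]; simp only [add_sub_cancel_left]; rw [abs_of_nonneg hx]; linarith)
  rw [hcr] at h1
  simp only [add_sub_cancel_left, norm_eq_abs, abs_of_nonneg hx] at h1
  have h2 : (c+x)^(1/(p-1)) ≤ (1-1/p) + |K| * x := by
    have := le_abs_self ((c+x)^(1/(p-1)) - (1-1/p))
    have := mul_le_mul_of_nonneg_right (le_abs_self K) hx
    linarith
  have hcx : 0 < c + x := by linarith
  -- Bernoulli
  have hq1 : 1 ≤ p/(p-1) := by rw [le_div_iff₀ hp1]; linarith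
  have h3 := one_add_mul_self_le_rpow_one_add (s := -(x/(c+x))) (by
    have : x/(c+x) ≤ 1 := by rw [div_le_one hcx]; linarith
    linarith) hq1
  have h4 : 1 + -(x/(c+x)) = c/(c+x) := by field_simp; ring_nf
  rw [h4, div_rpow hcpos.le hcx.le, le_div_iff₀ (rpow_pos_of_pos hcx _)] at h3
  have h5 : (c+x)^(p/(p-1)) = (c+x) * (c+x)^(1/(p-1)) := by
    rw [mul_comm, ← rpow_add_one hcx.ne']; congr 1; field_simp; ring_nf
  have h6 : (1 + p/(p-1) * -(x/(c+x))) * (c+x)^(p/(p-1)) = (c+x)^(p/(p-1)) - p/(p-1) * x * (c+x)^(1/(p-1)) := by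
    rw [h5]; field_simp; ring_nf
  rw [h6, hcq] at h3
  have h7 : p/(p-1) * x * (c+x)^(1/(p-1)) ≤ p/(p-1) * x * ((1-1/p) + |K| * x) := by gcongr
  have h8 : (c+x)^(p/(p-1)) ≤ (1-1/p)^p + p/(p-1) * x * ((1-1/p) + |K| * x) := by linarith
  have h9 : (p-1) * (p/(p-1) * x * ((1-1/p) + |K| * x)) = (p-1)*x + p * |K| * x^2 := by
    field_simp
  have h10 := mul_le_mul_of_nonneg_left h8 hp1.le
  rw [mul_add, h9] at h10
  have h11 : (p-1) * c - (p-1) * (1-1/p)^p = (1-1/p)^p := by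
    rw [hΛ]; field_simp; ring
  nlinarith [sq_nonneg x]

lemma hcs_young (p y d : ℝ) (hp : 1 < p) (hy : 0 ≤ y) (hd : 0 ≤ d) :
    p * y^(p-1) * d ≤ d^p + (p-1) * y^p := by
  have hp0 : 0 < p := by linarith
  have hp1 : 0 < p - 1 := by linarith
  have h := Real.young_inequality_of_nonneg hd (rpow_nonneg hy (p-1)) (Real.HolderConjugate.conjExponent hp)
  have h2 : (y^(p-1)) ^ (Real.conjExponent p) = y^p := by
    rw [← rpow_mul hy, Real.conjExponent]; congr 1; field_simp
  rw [h2, Real.conjExponent] at h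
  have h3 := mul_le_mul_of_nonneg_left h hp0.le
  have h4 : p * (d^p/p + y^p/(p/(p-1))) = d^p + (p-1) * y^p := by field_simp
  rw [h4] at h3
  linarith

lemma hcs_logs (R t : ℝ) (hR : Real.exp (Real.exp 1) < R) (ht : 0 < t) (ht1 : t ≤ 1) :
    1 ≤ log (R/t) ∧ 1 ≤ log (log (R/t)) ∧ t * log (R/t) * (log (log (R/t)))^2 ≤ 16 * R := by
  have hR0 : 0 < R := (exp_pos _).trans hR
  have hRt : R ≤ R/t := by rw [le_div_iff₀ ht]; nlinarith
  have hs : exp 1 ≤ log (R/t) := by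
    rw [le_log_iff_exp_le (by positivity)]; linarith
  have he : 1 ≤ exp 1 := one_le_exp (by norm_num)
  have hs1 : 1 ≤ log (R/t) := he.trans hs
  have hl : 1 ≤ log (log (R/t)) := by
    rw [le_log_iff_exp_le (by linarith)]; exact hs
  have key : ∀ x : ℝ, 0 < x → 0 ≤ log x → (log x)^2 ≤ 4 * x := by
    intro x hx hlx
    have h1 := log_le_sub_one_of_pos (sqrt_pos.2 hx)
    rw [log_sqrt hx.le] at h1
    have h2 := sq_sqrt hx.le
    have h3 := sqrt_nonneg x
    have : log x ≤ 2 * sqrt x := by linarith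
    nlinarith
  refine ⟨hs1, hl, ?_⟩
  have k1 := key _ (by linarith : 0 < log (R/t)) (by linarith)
  have k2 := key (R/t) (by positivity) (by linarith)
  have k3 : t * (R/t) = R := by field_simp
  calc t * log (R/t) * (log (log (R/t)))^2 ≤ t * log (R/t) * (4 * log (R/t)) := by gcongr
    _ = 4 * (t * (log (R/t))^2) := by ring
    _ ≤ 4 * (t * (4 * (R/t))) := by gcongr
    _ = 16 * (t * (R/t)) := by ring
    _ = 16 * R := by rw [k3]

lemma hcs_H (p R c δ C t : ℝ) (hR : 0 < R) (ht : 0 < t) (hs : 1 ≤ log (R/t))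
    (hl : 1 ≤ log (log (R/t))) :
    HasDerivAt (fun t => (1 - C * t) * ((log (R/t))^(1-p) * (c + δ / log (log (R/t)))))
      ((1 - C*t) * ((log (R/t))^(-p) / t * ((p-1) * (c + δ / log (log (R/t))) + δ / (log (log (R/t)))^2))
        - C * ((log (R/t))^(1-p) * (c + δ / log (log (R/t))))) t := by
  have hs0 : 0 < log (R/t) := by linarith
  have hl0 : 0 < log (log (R/t)) := by linarith
  have h1 : HasDerivAt (fun t : ℝ => R / t) (-R/t^2) t := by
    have := (hasDerivAt_inv ht.ne').const_mul R
    simpa [div_eq_mul_inv] using this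
  have h2 : HasDerivAt (fun t : ℝ => log (R / t)) (-1/t) t := by
    convert h1.log (by positivity) using 1
    field_simp
  have h3 := h2.rpow_const (p := 1-p) (Or.inl hs0.ne')
  have h4 := h2.log hs0.ne'
  have h5 := ((hasDerivAt_const t δ).div h4 hl0.ne').const_add c
  have h6 : HasDerivAt (fun t : ℝ => 1 - C * t) (-C) t := by
    simpa using ((hasDerivAt_id t).const_mul C).const_sub 1
  have h7 := h6.mul (h3.mul h5)
  refine h7.congr_deriv ?_
  have e1 : (log (R/t))^(1-p-1) = (log (R/t))^(-p) := by congr 1; ring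
  have e2 : (log (R/t))^(1-p) = (log (R/t))^(-p) * log (R/t) := by
    rw [← rpow_add_one hs0.ne']; congr 1; ring
  simp only [Pi.mul_apply, Pi.div_apply]
  rw [e1, e2]
  field_simp
  ring

lemma hcs_scalar (p R K δ B C t s l φ φq c Λ : ℝ) (hΛ : 0 ≤ Λ)  (hδ : 0 < δ)
    (hδ1 : δ ≤ 1) (hK : K * δ ≤ 1/2) (hc : 0 ≤ c) (ht : 0 < t) (hs : 1 ≤ s) (hl : 1 ≤ l)
    (htsl : t * s * l^2 ≤ 16 * R) (hφ : φ = c + δ / l) (hB : B = 2 * Λ + 2 + c)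
    (hC0 : 0 < C) (hC1 : C * t ≤ 1) (hC : C * (64 * R * B) = δ)
    (hF : Λ - K * (δ/l)^2 ≤ (p-1) * (φ - φq)) :
    (Λ + δ/4 / l^2) * (1 + C*t) ≤ (1 - C*t) * ((p-1) * φ - (p-1) * φq + δ/l^2) - C * t * s * φ := by
  have hl0 : 0 < l := by linarith
  set z := 1 / l^2 with hz
  have hz0 : 0 < z := by positivity
  have hz1 : z ≤ 1 := by rw [hz, div_le_one (by positivity)]; nlinarith
  have e1 : (δ/l)^2 = δ^2 * z := by rw [hz]; field_simp
  have e2 : δ/l^2 = δ * z := by rw [hz]; field_simp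
  have e3 : δ/4/l^2 = δ/4 * z := by rw [hz]; field_simp
  have hφ1 : φ ≤ c + 1 := by
    rw [hφ]; gcongr; rw [div_le_one hl0]; linarith
  rw [e1] at hF
  rw [e2, e3]
  have h1 : K * (δ^2 * z) ≤ δ/2 * z := by
    have := mul_le_mul_of_nonneg_right hK (by positivity : 0 ≤ δ * z)
    nlinarith
  have h2 : Λ + δ/2 * z ≤ (p-1) * φ - (p-1) * φq + δ * z := by linarith
  have h3 := mul_le_mul_of_nonneg_left h2 (by linarith : 0 ≤ 1 - C*t)
  have hts : t * s ≤ 16 * R * z := by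
    rw [hz, mul_one_div, le_div_iff₀ (by positivity)]; exact htsl
  have hB0 : 0 < B := by rw [hB]; linarith
  have h4 : C * (t * s) * B ≤ δ/4 * z := by
    calc C * (t * s) * B ≤ C * (16 * R * z) * B := by gcongr
      _ = (C * (64 * R * B)) / 4 * z := by ring
      _ = _ := by rw [hC]
  have h5 : C * t * s * φ ≤ C * t * s * (c+1) := by gcongr
  have h6 : C * t * (2 * Λ + δ * z) ≤ C * t * s * (2 * Λ + 1) := by
    have : δ * z ≤ 1 := by nlinarith
    have a1 : C * t * (2 * Λ + δ * z) ≤ C * t * (2 * Λ + 1) := by gcongr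
    have a2 : C * t * 1 * (2 * Λ + 1) ≤ C * t * s * (2 * Λ + 1) := by gcongr
    linarith
  have h7 : C * (t * s) * B = C * t * s * (2*Λ+1) + C * t * s * (c+1) := by rw [hB]; ring
  have h8 : 0 ≤ C * t * δ * z := by positivity
  nlinarith

lemma hcs_point (p t s M D φ C H' v d Z : ℝ) (hp : 1 < p) (ht : 0 < t) (hs : 0 < s)
    (hφ : 0 < φ) (hv : 0 ≤ v) (hd : 0 ≤ d) (hC1 : C * t ≤ 1)
    (hZ : |Z| ≤ p * v^(p-1) * d)
    (hH : H' = (1 - C*t) * (s^(-p) / t * ((p-1) * φ + D)) - C * (s^(1-p) * φ))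
    (hsc : M * (1 + C*t) ≤ (1 - C*t) * ((p-1) * φ - (p-1) * φ^(p/(p-1)) + D) - C * t * s * φ) :
    -(H' * v^p + (1 - C*t) * (s^(1-p) * φ) * Z) ≤
      (d^p - (v/t)^p * s^(-p) * M) * t^(p-1) - C * ((d^p + (v/t)^p * s^(-p) * M) * t^p) := by
  have hp1 : 0 < p - 1 := by linarith
  have hC2 : 0 ≤ 1 - C * t := by linarith
  have e1 : t^p = t^(p-1) * t := by rw [← rpow_add_one ht.ne']; congr 1; ring
  have e2 : (v/t)^p * t^(p-1) = v^p / t := by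
    rw [div_rpow hv ht.le, e1]
    have := rpow_pos_of_pos ht (p-1)
    field_simp
  have e3 : s^(1-p) = s^(-p) * s := by rw [← rpow_add_one hs.ne']; congr 1; ring
  have hψ : 0 ≤ φ^(1/(p-1)) := (rpow_pos_of_pos hφ _).le
  have hψ1 : (φ^(1/(p-1)))^(p-1) = φ := by
    rw [← rpow_mul hφ.le, one_div_mul_cancel hp1.ne', rpow_one]
  have hψ2 : (φ^(1/(p-1)))^p = φ^(p/(p-1)) := by
    rw [← rpow_mul hφ.le]; congr 1; field_simp
  have hst : 0 < s * t := by positivity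
  have hy := hcs_young p (φ^(1/(p-1)) * v / (s*t)) d hp (by positivity) hd
  have sp : 0 < s^(p-1) := rpow_pos_of_pos hs _
  have tp : 0 < t^(p-1) := rpow_pos_of_pos ht _
  have e4 : s^(1-p) = 1 / s^(p-1) := by
    rw [one_div, ← rpow_neg hs.le]; congr 1; ring
  have e5 : s^(-p) = 1 / s^p := by
    rw [one_div, ← rpow_neg hs.le]
  have e6 : (φ^(1/(p-1)) * v / (s*t))^(p-1) * t^(p-1) = φ * v^(p-1) * s^(1-p) := by
    rw [div_rpow (by positivity) hst.le, mul_rpow hψ hv, mul_rpow hs.le ht.le, hψ1, e4]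
    field_simp
  have sp' : 0 < s^p := rpow_pos_of_pos hs _
  have e7 : (φ^(1/(p-1)) * v / (s*t))^p * t^(p-1) = φ^(p/(p-1)) * v^p * s^(-p) / t := by
    rw [div_rpow (by positivity) hst.le, mul_rpow hψ hv, mul_rpow hs.le ht.le, hψ2, e5, e1]
    field_simp
  have h1 := mul_le_mul_of_nonneg_right hy tp.le
  have h2 : p * (φ * v^(p-1) * s^(1-p)) * d ≤
      d^p * t^(p-1) + (p-1) * (φ^(p/(p-1)) * v^p * s^(-p) / t) := by
    rw [← e6, ← e7]; linarith
  have h3 : -(s^(1-p) * φ * Z) ≤ p * (φ * v^(p-1) * s^(1-p)) * d := by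
    have q1 : -Z ≤ p * v^(p-1) * d := (neg_le_abs Z).trans hZ
    have q2 : 0 ≤ s^(1-p) * φ := by positivity
    have := mul_le_mul_of_nonneg_left q1 q2
    linarith
  have h4 := mul_le_mul_of_nonneg_left (h3.trans h2) hC2
  have q3 : 0 ≤ v^p * s^(-p) / t := by positivity
  have h5 := mul_le_mul_of_nonneg_right hsc q3
  have e8 : (d^p - (v/t)^p * s^(-p) * M) * t^(p-1) - C * ((d^p + (v/t)^p * s^(-p) * M) * t^p)
      = (1 - C*t) * (d^p * t^(p-1)) - M * (1 + C*t) * (v^p * s^(-p) / t) := by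
    have : v^p * s^(-p) / t = (v/t)^p * t^(p-1) * s^(-p) := by rw [e2]; ring
    rw [this, e1]; ring
  have e9 : H' * v^p = ((1 - C*t) * ((p-1) * φ + D) - C * t * s * φ) * (v^p * s^(-p) / t) := by
    rw [hH, e3]; field_simp
  rw [e8, e9]
  have e10 : (1 - C*t) * ((p-1) * (φ^(p/(p-1)) * v^p * s^(-p) / t))
      = (1 - C*t) * ((p-1) * φ^(p/(p-1))) * (v^p * s^(-p) / t) := by ring
  linarith

lemma hcs_restrict (f : ℝ → ℝ) (a b : ℝ) (hb : 0 < b) (hba : b < a) (hb1 : b < 1)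
    (hf : ∀ t < a, f t = 0) : ∫ t in Ioc (0:ℝ) 1, f t = ∫ t in b..1, f t := by
  rw [intervalIntegral.integral_of_le hb1.le]
  apply setIntegral_eq_of_subset_of_forall_sdiff_eq_zero measurableSet_Ioc
  · exact Ioc_subset_Ioc_left hb.le
  · rintro x ⟨hx, hx2⟩
    apply hf
    by_contra h
    exact hx2 ⟨by linarith, hx.2⟩

/-- Theorem 2.2 (2): critical case `α = 1 - 1/p` with sharp remainders. -/
theorem hardy_critical_sharp (p R : ℝ) (hp : 1 < p)
    (hR : Real.exp (Real.exp 1) < R) :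
    ∃ C₀ > (0:ℝ), ∃ C₁ > (0:ℝ), ∃ L > (0:ℝ), ∀ u : ℝ → ℝ, ContDiff ℝ (⊤ : ℕ∞) u →
      (∃ a > (0:ℝ), ∀ t < a, u t = 0) →
      (∫ t in Ioc (0:ℝ) 1,
          (|deriv u t| ^ p
            - (|u t| / t) ^ p * (Real.log (R / t)) ^ (-p)
              * ((1 - 1/p) ^ p + C₀ / (Real.log (Real.log (R / t))) ^ 2))
            * t ^ (p - 1))
        + L * |u 1| ^ p ≥
      C₁ * ∫ t in Ioc (0:ℝ) 1,
          (|deriv u t| ^ p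
            + (|u t| / t) ^ p * (Real.log (R / t)) ^ (-p)
              * ((1 - 1/p) ^ p + C₀ / (Real.log (Real.log (R / t))) ^ 2))
            * t ^ p := by
  have hp0 : 0 < p := by linarith
  have hp1 : 0 < p - 1 := by linarith
  have ha : 0 < 1 - 1/p := by
    rw [sub_pos, div_lt_one hp0]; exact hp
  have hR0 : 0 < R := (exp_pos _).trans hR
  have hR1 : 1 ≤ R := (one_le_exp (exp_pos _).le).trans hR.le
  obtain ⟨K, hK, e, he, hF⟩ := hcs_F p hp
  set c := (1-1/p)^(p-1) with hc
  have hcpos : 0 < c := rpow_pos_of_pos ha _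
  set Λ := (1-1/p)^p with hΛ
  have hΛpos : 0 < Λ := rpow_pos_of_pos ha _
  obtain ⟨δ, hδ, hδ1, hδe, hδK⟩ : ∃ δ : ℝ, 0 < δ ∧ δ ≤ 1 ∧ δ ≤ e ∧ K * δ ≤ 1/2 := by
    refine ⟨min 1 (min e (1/(2*K))), by positivity, min_le_left _ _,
      (min_le_right _ _).trans (min_le_left _ _), ?_⟩
    have : min 1 (min e (1/(2*K))) ≤ 1/(2*K) := (min_le_right _ _).trans (min_le_right _ _)
    calc K * _ ≤ K * (1/(2*K)) := by gcongr
      _ = 1/2 := by field_simp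
  set B := 2 * Λ + 2 + c with hB
  have hBpos : 1 ≤ B := by linarith
  set C := δ / (64 * R * B) with hCdef
  have hCpos : 0 < C := by positivity
  have hC1 : C ≤ 1 := by
    rw [hCdef, div_le_one (by positivity)]
    nlinarith
  have hCB : C * (64 * R * B) = δ := by rw [hCdef]; field_simp
  obtain ⟨hs1, hl1, -⟩ := hcs_logs R 1 hR one_pos le_rfl
  have hL : 0 < (log (R/1))^(1-p) * (c + δ / log (log (R/1))) := by
    have : 0 < log (R/1) := by linarith
    have : 0 < log (log (R/1)) := by linarith
    positivity
  refine ⟨δ/4, by positivity, C, hCpos, _, hL, ?_⟩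
  rintro u hu ⟨a, ha0, hua⟩
  have hu' : ∀ t < a, deriv u t = 0 := by
    intro t ht
    have : u =ᶠ[nhds t] fun _ => 0 := by
      filter_upwards [Iio_mem_nhds ht] with x hx using hua x hx
    rw [this.deriv_eq]; simp
  have hdiff : Differentiable ℝ u := hu.differentiable (by simp)
  have hcd : Continuous (deriv u) := hu.continuous_deriv (by simp)
  have hcu : Continuous u := hu.continuous
  obtain ⟨b, hb0, hba, hb1⟩ : ∃ b : ℝ, 0 < b ∧ b < a ∧ b < 1 := by
    have h := lt_min ha0 (one_pos : (0:ℝ) < 1)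
    refine ⟨min a 1 / 2, by positivity, ?_, ?_⟩
    · have := min_le_left a 1; linarith
    · have := min_le_right a 1; linarith
  rw [hcs_restrict _ a b hb0 hba hb1 (by
      intro t ht; simp [hua t ht, hu' t ht, zero_rpow hp0.ne']),
    hcs_restrict _ a b hb0 hba hb1 (by
      intro t ht; simp [hua t ht, hu' t ht, zero_rpow hp0.ne'])]
  have hpos : ∀ t ∈ Icc b 1, 0 < t ∧ 1 ≤ log (R/t) ∧ 1 ≤ log (log (R/t)) := by
    intro t ht
    have ht0 : 0 < t := by linarith [ht.1]
    have := hcs_logs R t hR ht0 ht.2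
    exact ⟨ht0, this.1, this.2.1⟩
  -- continuity of the ingredients
  have k0 : ContinuousOn (fun t : ℝ => R / t) (Icc b 1) :=
    continuousOn_const.div continuousOn_id (fun t ht => (hpos t ht).1.ne')
  have k1 : ContinuousOn (fun t : ℝ => log (R / t)) (Icc b 1) :=
    k0.log (fun t ht => (div_pos hR0 (hpos t ht).1).ne')
  have k2 : ContinuousOn (fun t : ℝ => log (log (R / t))) (Icc b 1) :=
    k1.log (fun t ht => by have := (hpos t ht).2.1; linarith)
  have k3 : ContinuousOn (fun t : ℝ => (log (R / t))^(-p)) (Icc b 1) :=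
    k1.rpow_const (fun t ht => Or.inl (by have := (hpos t ht).2.1; linarith))
  have k4 : ContinuousOn (fun t : ℝ => Λ + δ/4 / (log (log (R / t)))^2) (Icc b 1) :=
    continuousOn_const.add (continuousOn_const.div (k2.pow 2)
      (fun t ht => by have := (hpos t ht).2.2; positivity))
  have k5 : ContinuousOn (fun t : ℝ => (|u t| / t)^p) (Icc b 1) :=
    (hcu.abs.continuousOn.div continuousOn_id (fun t ht => (hpos t ht).1.ne')).rpow_const
      (fun t ht => Or.inr hp0.le)
  have k6 : ContinuousOn (fun t : ℝ => |deriv u t|^p) (Icc b 1) :=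
    hcd.abs.continuousOn.rpow_const (fun t ht => Or.inr hp0.le)
  have k7 : ContinuousOn (fun t : ℝ => t^p) (Icc b 1) :=
    continuousOn_id.rpow_const (fun t ht => Or.inr hp0.le)
  have k8 : ContinuousOn (fun t : ℝ => t^(p-1)) (Icc b 1) :=
    continuousOn_id.rpow_const (fun t ht => Or.inr hp1.le)
  have f1 := (k6.sub ((k5.mul k3).mul k4)).mul k8
  have f2 := (k6.add ((k5.mul k3).mul k4)).mul k7
  have hF1 := f1.intervalIntegrable_of_Icc hb1.le (μ := volume)
  have hF2 := f2.intervalIntegrable_of_Icc hb1.le (μ := volume)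
  have hWd : ∀ t ∈ Icc b 1, HasDerivAt (fun t => -(((1 - C * t) *
      ((log (R/t))^(1-p) * (c + δ / log (log (R/t))))) * |u t|^p))
      (-(((1 - C*t) * ((log (R/t))^(-p) / t * ((p-1) * (c + δ / log (log (R/t)))
        + δ / (log (log (R/t)))^2)) - C * ((log (R/t))^(1-p) * (c + δ / log (log (R/t))))) * |u t|^p
        + ((1 - C * t) * ((log (R/t))^(1-p) * (c + δ / log (log (R/t)))))
          * (p * |u t|^(p-2) * u t * deriv u t))) t := by
    intro t ht
    obtain ⟨h1, h2, h3⟩ := hpos t ht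
    have hh := hcs_H p R c δ C t hR0 h1 h2 h3
    have h4 : HasDerivAt (fun t => |u t|^p) (p * |u t|^(p-2) * u t * deriv u t) t :=
      (hasDerivAt_abs_rpow (u t) hp).comp t (hdiff t).hasDerivAt
    exact (hh.mul h4).neg
  have main := intervalIntegral.sub_le_integral_of_hasDeriv_right_of_le hb1.le
    (fun t ht => (hWd t ht).continuousAt.continuousWithinAt)
    (fun t ht => (hWd t (Ioo_subset_Icc_self ht)).hasDerivWithinAt)
    ((f1.sub (f2.const_mul C)).integrableOn_Icc) (by
      intro t ht
      have ht' := Ioo_subset_Icc_self ht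
      obtain ⟨h1, h2, h3⟩ := hpos t ht'
      have h4 := (hcs_logs R t hR h1 ht'.2).2.2
      have hl0 : 0 < log (log (R/t)) := by linarith
      have hCt : C * t ≤ 1 := by nlinarith [ht'.2]
      have hx : δ / log (log (R/t)) ≤ e := by
        refine le_trans ?_ hδe
        rw [div_le_iff₀ hl0]; nlinarith
      refine hcs_point p t (log (R/t)) _ _ (c + δ / log (log (R/t))) C _ |u t| |deriv u t| _ hp h1
        (by linarith) (by positivity) (abs_nonneg _) (abs_nonneg _) hCt ?_ rfl ?_
      · rcases eq_or_ne (u t) 0 with h0 | h0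
        · simp [h0, zero_rpow hp1.ne']
        · have : |u t|^(p-1) = |u t|^(p-2) * |u t| := by
            rw [← rpow_add_one (abs_ne_zero.2 h0)]; congr 1; ring
          rw [this, abs_mul, abs_mul, abs_mul, abs_of_pos hp0,
            abs_of_nonneg (rpow_nonneg (abs_nonneg _) _)]
          apply le_of_eq; ring
      · exact hcs_scalar p R K δ B C t _ _ _ _ c Λ hΛpos.le hδ hδ1 hδK hcpos.le h1 h2 h3 h4 rfl hB
          hCpos hCt hCB (hF _ (by positivity) hx))
  have e1 := intervalIntegral.integral_sub hF1 (hF2.const_mul C)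
  rw [intervalIntegral.integral_const_mul] at e1
  have main2 := main.trans_eq e1
  have hub : |u b|^p = 0 := by rw [hua b hba]; simp [zero_rpow hp0.ne']
  rw [hub] at main2
  have hu1 : 0 ≤ |u 1|^p := rpow_nonneg (abs_nonneg _) _
  have h9 : 0 ≤ C * ((log (R/1))^(1-p) * (c + δ / log (log (R/1)))) * |u 1|^p := by positivity
  simp only [Pi.mul_apply, Pi.sub_apply, Pi.add_apply] at main2
  linarith
end
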